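/- Let X̄ = (X̄₁,...,X̄_d), X = (X₁,...,X_d), X̂ = (X̂₁,...,X̂_d) be unit Fréchet MEV vectors such that the subvectors X̂_{I_j}, j=1,...,p, are mutually independent, the subvectors X̄_{I_j}, j=1,...,p, are totally dependent, and for each j the subvectors X̂_{I_j}, X̄_{I_j}, X_{I_j} are identically distributed. Then for every λ ∈ (0,∞)^p and partition I of {1,...,d}: R(X̄,λ,I) ≤ R(X,λ,I) ≤ R(X̂,λ,I). -/

import Mathlib

open MeasureTheory Finset

/-- Unit Fréchet distribution function F(x) = exp(-1/x). -/
noncomputable def frechetCDF (x : ℝ) : ℝ := Real.exp (-x⁻¹)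


lemma aux_prod_one_sub {ι : Type*} [DecidableEq ι] (s : Finset ι) (x : ι → ℝ) :
    ∏ j ∈ s, (1 - x j) = ∑ R ∈ s.powerset, (-1 : ℝ) ^ (#R) * ∏ j ∈ R, x j := by
  have h : ∀ j ∈ s, 1 - x j = -x j + 1 := fun j _ => by ring
  rw [Finset.prod_congr rfl h, Finset.prod_add]
  refine Finset.sum_congr rfl fun R _ => ?_
  rw [Finset.prod_neg]; simp

/-- The exponent functional of a Poisson family of subsets. -/
noncomputable def auxEll {p : ℕ} (nu : Finset (Fin p) → ℝ) (S : Finset (Fin p)) : ℝ :=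
  ∑ T, if Disjoint T S then 0 else nu T

/-- Weight of a configuration. -/
noncomputable def auxW {p : ℕ} (nu : Finset (Fin p) → ℝ) (C : Finset (Finset (Fin p))) : ℝ :=
  ∏ T, if T ∈ C then 1 - Real.exp (-nu T) else Real.exp (-nu T)

/-- Indicator that `j` is not covered by the configuration. -/
noncomputable def auxX {p : ℕ} (j : Fin p) (C : Finset (Finset (Fin p))) : ℝ :=
  if ∀ T ∈ C, j ∉ T then 1 else 0

lemma auxW_sum {p : ℕ} (nu : Finset (Fin p) → ℝ) (R : Finset (Fin p)) :
    ∑ C, auxW nu C * ∏ j ∈ R, auxX j C = Real.exp (-auxEll nu R) := by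
  have h1 : ∀ C : Finset (Finset (Fin p)), auxW nu C * ∏ j ∈ R, auxX j C =
      (∏ T ∈ C, if Disjoint T R then 1 - Real.exp (-nu T) else 0) *
        ∏ T ∈ univ \ C, Real.exp (-nu T) := by
    intro C
    have hw : auxW nu C = (∏ T ∈ C, (1 - Real.exp (-nu T))) * ∏ T ∈ univ \ C, Real.exp (-nu T) := by
      unfold auxW
      rw [Finset.prod_ite]
      congr 1
      · congr 1; ext; simp
      · congr 1; ext; simp
    by_cases h : ∀ T ∈ C, Disjoint T R
    · have : ∏ j ∈ R, auxX j C = 1 := by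
        apply Finset.prod_eq_one
        intro j hj
        unfold auxX
        rw [if_pos]
        intro T hT hjT
        exact Finset.disjoint_left.1 (h T hT) hjT hj
      rw [this, mul_one, hw]
      congr 1
      exact Finset.prod_congr rfl fun T hT => by rw [if_pos (h T hT)]
    · push Not at h
      obtain ⟨T, hT, hTR⟩ := h
      have e1 : (∏ T ∈ C, if Disjoint T R then 1 - Real.exp (-nu T) else 0) = 0 :=
        Finset.prod_eq_zero hT (if_neg hTR)
      rw [Finset.not_disjoint_iff] at hTR
      obtain ⟨j, hjT, hjR⟩ := hTR
      have e2 : ∏ j ∈ R, auxX j C = 0 := by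
        apply Finset.prod_eq_zero hjR
        unfold auxX
        rw [if_neg]
        intro h; exact h T hT hjT
      rw [e1, e2]; simp
  rw [Finset.sum_congr rfl fun C _ => h1 C]
  have := Finset.prod_add (fun T => if Disjoint T R then 1 - Real.exp (-nu T) else 0)
    (fun T => Real.exp (-nu T)) (univ : Finset (Finset (Fin p)))
  rw [Finset.powerset_univ] at this
  rw [← this]
  unfold auxEll
  rw [← Finset.sum_neg_distrib, Real.exp_sum]
  refine Finset.prod_congr rfl fun T _ => ?_
  split_ifs <;> simp

lemma aux_poisson {p : ℕ} (nu : Finset (Fin p) → ℝ) (hnu : ∀ T, 0 ≤ nu T) :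
    ∏ j, (1 - Real.exp (-auxEll nu {j})) ≤
      ∑ R ∈ (univ : Finset (Fin p)).powerset, (-1 : ℝ) ^ (#R) * Real.exp (-auxEll nu R) := by
  have hW0 : 0 ≤ auxW nu := by
    intro C
    refine Finset.prod_nonneg fun T _ => ?_
    split_ifs
    · have : Real.exp (-nu T) ≤ 1 := Real.exp_le_one_iff.2 (by linarith [hnu T])
      linarith
    · positivity
  have hWm : ∀ C D, auxW nu C * auxW nu D ≤ auxW nu (C ⊓ D) * auxW nu (C ⊔ D) := by
    intro C D
    apply le_of_eq
    unfold auxW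
    rw [← Finset.prod_mul_distrib, ← Finset.prod_mul_distrib]
    refine Finset.prod_congr rfl fun T _ => ?_
    by_cases h1 : T ∈ C <;> by_cases h2 : T ∈ D <;> simp [h1, h2, mul_comm]
  have hW1 : ∑ C, auxW nu C = 1 := by
    have := auxW_sum nu ∅
    simpa [auxEll] using this
  have hX01 : ∀ j (C : Finset (Finset (Fin p))), 0 ≤ 1 - auxX j C := by
    intro j C; unfold auxX; split_ifs <;> norm_num
  have hXm : ∀ j : Fin p, Monotone (fun C => 1 - auxX j C) := by
    intro j C D hCD
    dsimp only
    unfold auxX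
    split_ifs with h1 h2 h2
    · norm_num
    · norm_num
    · exact absurd (fun T hT => h2 T (hCD hT)) h1
    · norm_num
  have key : ∀ S : Finset (Fin p), ∏ j ∈ S, (1 - Real.exp (-auxEll nu {j})) ≤
      ∑ C, auxW nu C * ∏ j ∈ S, (1 - auxX j C) := by
    intro S
    induction S using Finset.induction_on with
    | empty => simp [hW1]
    | insert a S ha ih =>
      have e1 : 1 - Real.exp (-auxEll nu {a}) = ∑ C, auxW nu C * (1 - auxX a C) := by
        have := auxW_sum nu {a}
        simp only [Finset.prod_singleton] at this
        rw [← this]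
        simp only [mul_sub, Finset.sum_sub_distrib, mul_one, hW1]
      have := fkg (μ := auxW nu) (f := fun C => 1 - auxX a C)
        (g := fun C => ∏ j ∈ S, (1 - auxX j C)) hW0 (fun C => hX01 a C)
        (fun C => Finset.prod_nonneg fun j _ => hX01 j C) (hXm a)
        (fun C D h => Finset.prod_le_prod (fun j _ => hX01 j C) fun j _ => hXm j h) hWm
      rw [hW1, one_mul] at this
      simp only [Finset.prod_insert ha]
      refine le_trans ?_ this
      rw [← e1]
      refine mul_le_mul_of_nonneg_left ih ?_
      rw [e1]
      exact Finset.sum_nonneg fun C _ => mul_nonneg (hW0 C) (hX01 a C)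
  refine (key univ).trans (le_of_eq ?_)
  simp only [aux_prod_one_sub, Finset.mul_sum]
  rw [Finset.sum_comm]
  refine Finset.sum_congr rfl fun R _ => ?_
  rw [← auxW_sum, Finset.mul_sum]
  exact Finset.sum_congr rfl fun C _ => by ring

lemma auxEll_subadd {p : ℕ} (nu : Finset (Fin p) → ℝ) (hnu : ∀ T, 0 ≤ nu T) :
    auxEll nu univ ≤ ∑ j, auxEll nu {j} := by
  unfold auxEll
  rw [Finset.sum_comm]
  refine Finset.sum_le_sum fun T _ => ?_
  have h0 : ∀ j : Fin p, 0 ≤ (if Disjoint T {j} then 0 else nu T) := by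
    intro j; split_ifs; exacts [le_rfl, hnu T]
  split_ifs with h
  · exact Finset.sum_nonneg fun j _ => h0 j
  · rw [Finset.not_disjoint_iff] at h
    obtain ⟨j, hj, -⟩ := h
    calc nu T = (if Disjoint T {j} then 0 else nu T) := by simp [hj]
      _ ≤ _ := Finset.single_le_sum (f := fun j => if Disjoint T {j} then 0 else nu T)
        (fun j _ => h0 j) (Finset.mem_univ j)

lemma aux_limit {p : ℕ} (l : Finset (Fin p) → ℝ) (P : ℕ → Finset (Fin p) → ℝ)
    (hP : ∀ n T, 0 ≤ P n T)
    (h : ∀ n : ℕ, 0 < n → ∀ S, auxEll (P n) S = 1 - Real.exp (-(l S / n))) :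
    l univ ≤ ∑ j, l {j} ∧ ∏ j, (1 - Real.exp (-l {j})) ≤
      ∑ R ∈ (univ : Finset (Fin p)).powerset, (-1 : ℝ) ^ (#R) * Real.exp (-l R) := by
  have hlim : ∀ S, Filter.Tendsto (fun n : ℕ => auxEll (fun T => n * P n T) S) Filter.atTop
      (nhds (l S)) := by
    intro S
    have h1 : HasDerivAt (fun x : ℝ => Real.exp (-(l S * x))) (-l S) 0 := by
      have : HasDerivAt (fun x : ℝ => -(l S * x)) (-l S) 0 := by
        simpa using ((hasDerivAt_id (0:ℝ)).const_mul (l S)).fun_neg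
      simpa using this.exp
    have h2 := h1.tendsto_slope_zero
    have h3 : Filter.Tendsto (fun n : ℕ => ((n:ℝ))⁻¹) Filter.atTop (nhdsWithin 0 {0}ᶜ) := by
      rw [tendsto_nhdsWithin_iff]
      refine ⟨tendsto_inv_atTop_nhds_zero_nat, ?_⟩
      filter_upwards [Filter.eventually_gt_atTop 0] with n hn
      simp; omega
    have h4 := (h2.comp h3).neg
    rw [neg_neg] at h4
    refine h4.congr' ?_
    filter_upwards [Filter.eventually_gt_atTop 0] with n hn
    have : auxEll (fun T => n * P n T) S = n * auxEll (P n) S := by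
      unfold auxEll
      rw [Finset.mul_sum]
      refine Finset.sum_congr rfl fun T _ => ?_
      split_ifs <;> simp
    rw [this, h n hn]
    simp [div_eq_mul_inv]
    ring
  have hnn : ∀ n : ℕ, ∀ T, 0 ≤ (fun T => n * P n T) T := fun n T =>
    mul_nonneg (Nat.cast_nonneg n) (hP n T)
  constructor
  · exact le_of_tendsto_of_tendsto' (b := (Filter.atTop : Filter ℕ)) (hlim univ) (tendsto_finsetSum _ fun j _ => hlim {j})
      fun n => auxEll_subadd _ (hnn n)
  · refine le_of_tendsto_of_tendsto' (b := (Filter.atTop : Filter ℕ)) (tendsto_finsetProd _ fun j _ => ?_)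
      (tendsto_finsetSum _ fun R _ => ?_) fun n => aux_poisson _ (hnn n)
    · exact tendsto_const_nhds.sub ((Real.continuous_exp.tendsto _).comp (hlim {j}).neg)
    · exact ((Real.continuous_exp.tendsto _).comp (hlim R).neg).const_mul _

lemma aux_incl_excl {Ω : Type*} [MeasurableSpace Ω] (μ : Measure Ω) [IsProbabilityMeasure μ]
    {p : ℕ} (W : Fin p → Ω → ℝ) (hW : ∀ j, Measurable (W j)) (s : ℝ) :
    μ.real {ω | ∀ j, s < W j ω} = ∑ R ∈ (univ : Finset (Fin p)).powerset,
      (-1 : ℝ) ^ (#R) * μ.real {ω | ∀ j ∈ R, W j ω ≤ s} := by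
  have hm : ∀ R : Finset (Fin p), MeasurableSet {ω | ∀ j ∈ R, W j ω ≤ s} := fun R => by
    measurability
  have hm2 : MeasurableSet {ω | ∀ j, s < W j ω} := by
    measurability
  rw [← integral_indicator_one hm2]
  simp_rw [← integral_indicator_one (hm _), ← integral_const_mul]
  rw [← integral_finsetSum]
  · refine integral_congr_ae (Filter.Eventually.of_forall fun ω => ?_)
    have h1 : ∀ R : Finset (Fin p), Set.indicator {ω | ∀ j ∈ R, W j ω ≤ s} (1 : Ω → ℝ) ω =
        ∏ j ∈ R, (if W j ω ≤ s then (1:ℝ) else 0) := by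
      intro R
      by_cases h : ∀ j ∈ R, W j ω ≤ s
      · rw [Set.indicator_of_mem (by exact h), Finset.prod_eq_one]
        · rfl
        · intro j hj; rw [if_pos (h j hj)]
      · rw [Set.indicator_of_notMem (by exact h)]
        push Not at h
        obtain ⟨j, hj, hjs⟩ := h
        rw [Finset.prod_eq_zero hj]
        rw [if_neg (not_le.2 hjs)]
    simp only [h1]
    rw [← aux_prod_one_sub]
    by_cases h : ∀ j, s < W j ω
    · rw [Set.indicator_of_mem (by exact h), Finset.prod_eq_one]
      · rfl
      · intro j hj; rw [if_neg (not_le.2 (h j))]; simp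
    · rw [Set.indicator_of_notMem (by exact h)]
      push Not at h
      obtain ⟨j, hj⟩ := h
      rw [Finset.prod_eq_zero (Finset.mem_univ j)]
      rw [if_pos hj]; simp
  · intro R _
    exact ((integrable_const (1:ℝ)).indicator (hm R)).const_mul _

/-- Letting some thresholds go to infinity. -/
lemma aux_lim {Ω : Type*} [MeasurableSpace Ω] (μ : Measure Ω) [IsProbabilityMeasure μ]
    {d : ℕ} (X : Fin d → Ω → ℝ) (Q P : Fin d → Prop) [DecidablePred P] (a : Fin d → ℝ) :
    Filter.Tendsto (fun m : ℝ => μ.real {ω | ∀ i, Q i → X i ω ≤ if P i then a i else m})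
      Filter.atTop (nhds (μ.real {ω | ∀ i, Q i → P i → X i ω ≤ a i})) := by
  have hmono : Monotone (fun m : ℝ => {ω | ∀ i, Q i → X i ω ≤ if P i then a i else m}) := by
    intro m n hmn ω h i hi
    refine (h i hi).trans ?_
    split_ifs; exacts [le_rfl, hmn]
  have hU : (⋃ m : ℝ, {ω | ∀ i, Q i → X i ω ≤ if P i then a i else m}) =
      {ω | ∀ i, Q i → P i → X i ω ≤ a i} := by
    ext ω
    simp only [Set.mem_iUnion, Set.mem_ofPred_eq]
    constructor
    · rintro ⟨m, h⟩ i hQ hP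
      simpa [hP] using h i hQ
    · intro h
      refine ⟨∑ i, |X i ω|, fun i hQ => ?_⟩
      split_ifs with hP
      · exact h i hQ hP
      · exact (le_abs_self _).trans (Finset.single_le_sum (f := fun i => |X i ω|)
          (fun i _ => abs_nonneg _) (Finset.mem_univ i))
  have := tendsto_measure_iUnion_atTop (μ := μ) hmono
  rw [hU] at this
  exact (ENNReal.tendsto_toReal (measure_ne_top _ _)).comp this

lemma aux_assoc {Ω : Type*} [MeasurableSpace Ω] (μ : Measure Ω) [IsProbabilityMeasure μ]
    {p : ℕ} (W : Fin p → Ω → ℝ) (hW : ∀ j, Measurable (W j))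
    (H : ∀ R : Finset (Fin p), ∀ t s : ℝ, 0 < t → 0 < s →
      (μ.real {ω | ∀ j ∈ R, W j ω ≤ t * s}) ^ t = μ.real {ω | ∀ j ∈ R, W j ω ≤ s})
    (s : ℝ) (hs : 0 < s) :
    ∏ j, μ.real {ω | W j ω ≤ s} ≤ μ.real {ω | ∀ j, W j ω ≤ s} ∧
    ∏ j, (1 - μ.real {ω | W j ω ≤ s}) ≤ μ.real {ω | ∀ j, s < W j ω} := by
  have hpos : ∀ R : Finset (Fin p), 0 < μ.real {ω | ∀ j ∈ R, W j ω ≤ s} := by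
    intro R
    have h1 := aux_lim μ W (fun j => j ∈ R) (fun _ => False) (fun _ => 0)
    simp only [if_false, false_imp_iff, imp_true_iff, Set.ofPred_true, probReal_univ] at h1
    have h2 := (h1.eventually (lt_mem_nhds (zero_lt_one))).and (Filter.eventually_gt_atTop 0)
    obtain ⟨m, hm, hm0⟩ := h2.exists
    rw [← H R (m / s) s (by positivity) hs, div_mul_cancel₀ _ hs.ne']
    positivity
  set l : Finset (Fin p) → ℝ := fun R => -Real.log (μ.real {ω | ∀ j ∈ R, W j ω ≤ s}) with hl
  have hexp : ∀ R, Real.exp (-l R) = μ.real {ω | ∀ j ∈ R, W j ω ≤ s} := by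
    intro R; rw [hl]; simp only [neg_neg]; exact Real.exp_log (hpos R)
  have hscale : ∀ n : ℕ, 0 < n → ∀ R, μ.real {ω | ∀ j ∈ R, W j ω ≤ n * s} =
      Real.exp (-(l R / n)) := by
    intro n hn R
    have hn' : (0:ℝ) < n := by exact_mod_cast hn
    have h1 := H R n s hn' hs
    rw [← hexp R] at h1
    have h2 : Real.exp (-l R) = (Real.exp (-(l R / n))) ^ (n:ℝ) := by
      rw [← Real.exp_mul]; congr 1; field_simp
    rw [h2] at h1
    exact (Real.rpow_left_inj measureReal_nonneg (Real.exp_pos _).le hn'.ne').1 h1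
  let B : ℕ → Ω → Finset (Fin p) := fun n ω => univ.filter fun j => n * s < W j ω
  have hB : ∀ n T, MeasurableSet (B n ⁻¹' {T}) := by
    intro n T
    have : B n ⁻¹' {T} = ⋂ j, {ω | (n * s < W j ω ↔ j ∈ T)} := by
      ext ω
      simp [B, Finset.ext_iff]
    rw [this]
    refine MeasurableSet.iInter fun j => ?_
    exact MeasurableSet.iff (measurableSet_lt measurable_const (hW j)) (MeasurableSet.const _)
  have key := aux_limit l (fun n T => μ.real (B n ⁻¹' {T})) (fun n T => measureReal_nonneg) (by
    intro n hn S
    rw [← hscale n hn S]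
    have hm : MeasurableSet {ω | ∀ j ∈ S, W j ω ≤ n * s} := by measurability
    rw [← probReal_compl_eq_one_sub hm]
    have : {ω | ∀ j ∈ S, W j ω ≤ n * s}ᶜ = ⋃ T ∈ univ.filter (fun T => ¬ Disjoint T S),
        B n ⁻¹' {T} := by
      ext ω
      simp [B, Finset.not_disjoint_iff]
      grind
    rw [this, measureReal_biUnion_finset]
    · unfold auxEll
      rw [Finset.sum_filter]
      refine Finset.sum_congr rfl fun T _ => ?_
      split_ifs <;> simp_all
    · intro T _ T' _ hTT
      refine Set.disjoint_left.2 fun ω h h' => hTT ?_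
      exact h.symm.trans h'
    · exact fun T _ => hB n T)
  have hsing : ∀ j, Real.exp (-l {j}) = μ.real {ω | W j ω ≤ s} := by
    intro j; rw [hexp]; simp
  have huniv : Real.exp (-l univ) = μ.real {ω | ∀ j, W j ω ≤ s} := by
    rw [hexp]; simp
  constructor
  · rw [← huniv]
    simp_rw [← hsing]
    rw [← Real.exp_sum, Finset.sum_neg_distrib]
    exact Real.exp_le_exp.2 (neg_le_neg key.1)
  · rw [aux_incl_excl μ W hW s]
    simp_rw [← hsing, ← hexp]
    exact key.2

/-- Stochastic comparison of integrals. -/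
lemma aux_stoch {Ω : Type*} [MeasurableSpace Ω] (μ : Measure Ω) [IsProbabilityMeasure μ]
    (U V : Ω → ℝ) (hU : Measurable U) (hV : Measurable V)
    (hU0 : ∀ᵐ ω ∂μ, 0 ≤ U ω ∧ U ω ≤ 1) (hV0 : ∀ᵐ ω ∂μ, 0 ≤ V ω ∧ V ω ≤ 1)
    (h : ∀ t : ℝ, 0 < t → t < 1 → μ {ω | t < U ω} ≤ μ {ω | t < V ω}) :
    ∫ ω, U ω ∂μ ≤ ∫ ω, V ω ∂μ := by
  have hU0' : 0 ≤ᵐ[μ] U := hU0.mono fun ω h => h.1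
  have hV0' : 0 ≤ᵐ[μ] V := hV0.mono fun ω h => h.1
  rw [integral_eq_lintegral_of_nonneg_ae hU0' hU.aestronglyMeasurable,
    integral_eq_lintegral_of_nonneg_ae hV0' hV.aestronglyMeasurable]
  refine ENNReal.toReal_mono ?_ ?_
  · refine ne_of_lt (lt_of_le_of_lt (lintegral_mono_ae (g := fun _ => 1) ?_) (by simp))
    filter_upwards [hV0] with ω h
    exact ENNReal.ofReal_le_one.2 h.2
  · rw [lintegral_eq_lintegral_meas_lt μ hU0' hU.aemeasurable,
      lintegral_eq_lintegral_meas_lt μ hV0' hV.aemeasurable]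
    refine setLIntegral_mono' measurableSet_Ioi fun t ht => ?_
    by_cases h1 : t < 1
    · exact h t ht h1
    · have : μ {ω | t < U ω} = 0 := by
        rw [← nonpos_iff_eq_zero, ← show μ {ω | ¬ (0 ≤ U ω ∧ U ω ≤ 1)} = 0 from hU0]
        refine measure_mono fun ω hω h2 => ?_
        simp only [Set.mem_ofPred_eq] at hω
        linarith [h2.2]
      rw [this]; exact zero_le

lemma aux_level (m lam t : ℝ) (hm : 0 < m) (hlam : 0 < lam) (ht0 : 0 < t) (ht1 : t < 1) :
    t < frechetCDF m ^ lam ↔ (-Real.log t)⁻¹ < m / lam := by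
  have hlog : 0 < -Real.log t := neg_pos.2 (Real.log_neg ht0 ht1)
  unfold frechetCDF
  rw [← Real.exp_mul, ← Real.log_lt_iff_lt_exp ht0, inv_lt_comm₀ hlog (by positivity), inv_div]
  have : -m⁻¹ * lam = -(lam / m) := by rw [div_eq_mul_inv]; ring
  rw [this]
  constructor <;> intro h <;> linarith

lemma aux_cmp {Ω : Type*} [MeasurableSpace Ω] (μ : Measure Ω) [IsProbabilityMeasure μ]
    {p : ℕ} (hne : (univ : Finset (Fin p)).Nonempty) (lam : Fin p → ℝ) (hlam : ∀ j, 0 < lam j)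
    (M N : Fin p → Ω → ℝ) (hM : ∀ j, Measurable (M j)) (hN : ∀ j, Measurable (N j))
    (hM0 : ∀ᵐ ω ∂μ, ∀ j, 0 < M j ω) (hN0 : ∀ᵐ ω ∂μ, ∀ j, 0 < N j ω)
    (h1 : ∀ s : ℝ, 0 < s → μ.real {ω | ∀ j, N j ω / lam j ≤ s} ≤
      μ.real {ω | ∀ j, M j ω / lam j ≤ s})
    (h2 : ∀ s : ℝ, 0 < s → μ.real {ω | ∀ j, s < N j ω / lam j} ≤
      μ.real {ω | ∀ j, s < M j ω / lam j}) :
    ∫ ω, (univ.sup' hne (fun j => frechetCDF (M j ω) ^ lam j)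
        - univ.inf' hne (fun j => frechetCDF (M j ω) ^ lam j)) ∂μ ≤
    ∫ ω, (univ.sup' hne (fun j => frechetCDF (N j ω) ^ lam j)
        - univ.inf' hne (fun j => frechetCDF (N j ω) ^ lam j)) ∂μ := by
  have meas : ∀ (K : Fin p → Ω → ℝ), (∀ j, Measurable (K j)) →
      ∀ j, Measurable (fun ω => frechetCDF (K j ω) ^ lam j) := by
    intro K hK j
    unfold frechetCDF
    have := hK j
    fun_prop
  have msup : ∀ (K : Fin p → Ω → ℝ), (∀ j, Measurable (K j)) →
      Measurable (fun ω => univ.sup' hne (fun j => frechetCDF (K j ω) ^ lam j)) := by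
    intro K hK
    have := Finset.measurable_sup' hne (f := fun j ω => frechetCDF (K j ω) ^ lam j)
      fun j _ => meas K hK j
    convert this using 1
    ext ω; simp [Finset.sup'_apply]
  have minf : ∀ (K : Fin p → Ω → ℝ), (∀ j, Measurable (K j)) →
      Measurable (fun ω => univ.inf' hne (fun j => frechetCDF (K j ω) ^ lam j)) := by
    intro K hK
    refine measurable_of_Ioi fun t => ?_
    have : (fun ω => univ.inf' hne (fun j => frechetCDF (K j ω) ^ lam j)) ⁻¹' Set.Ioi t =
        ⋂ j, {ω | t < frechetCDF (K j ω) ^ lam j} := by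
      ext ω; simp [Finset.lt_inf'_iff]
    rw [this]
    exact MeasurableSet.iInter fun j => measurableSet_lt measurable_const (meas K hK j)
  have b01 : ∀ m l : ℝ, 0 < m → 0 < l → 0 ≤ frechetCDF m ^ l ∧ frechetCDF m ^ l ≤ 1 := by
    intro m l hm hl
    unfold frechetCDF
    have : 0 < m⁻¹ := by positivity
    exact ⟨by positivity, Real.rpow_le_one (Real.exp_pos _).le
      (Real.exp_le_one_iff.2 (by linarith)) hl.le⟩
  obtain ⟨j0, -⟩ := id hne
  have bsup : ∀ (K : Fin p → Ω → ℝ), (∀ᵐ ω ∂μ, ∀ j, 0 < K j ω) → ∀ᵐ ω ∂μ,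
      0 ≤ univ.sup' hne (fun j => frechetCDF (K j ω) ^ lam j) ∧
      univ.sup' hne (fun j => frechetCDF (K j ω) ^ lam j) ≤ 1 := by
    intro K hK
    filter_upwards [hK] with ω h
    exact ⟨(b01 _ _ (h j0) (hlam j0)).1.trans
      (Finset.le_sup' (fun j => frechetCDF (K j ω) ^ lam j) (mem_univ j0)),
      Finset.sup'_le _ _ fun j _ => (b01 _ _ (h j) (hlam j)).2⟩
  have binf : ∀ (K : Fin p → Ω → ℝ), (∀ᵐ ω ∂μ, ∀ j, 0 < K j ω) → ∀ᵐ ω ∂μ,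
      0 ≤ univ.inf' hne (fun j => frechetCDF (K j ω) ^ lam j) ∧
      univ.inf' hne (fun j => frechetCDF (K j ω) ^ lam j) ≤ 1 := by
    intro K hK
    filter_upwards [hK] with ω h
    exact ⟨Finset.le_inf' _ _ fun j _ => (b01 _ _ (h j) (hlam j)).1,
      (Finset.inf'_le (fun j => frechetCDF (K j ω) ^ lam j) (mem_univ j0)).trans
      (b01 _ _ (h j0) (hlam j0)).2⟩
  have integ : ∀ f : Ω → ℝ, Measurable f → (∀ᵐ ω ∂μ, 0 ≤ f ω ∧ f ω ≤ 1) → Integrable f μ := by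
    intro f hf hb
    refine Integrable.of_bound hf.aestronglyMeasurable 1 ?_
    filter_upwards [hb] with ω h
    rw [Real.norm_eq_abs, abs_of_nonneg h.1]; exact h.2
  have lsup : ∀ (K : Fin p → Ω → ℝ), (∀ j, Measurable (K j)) → (∀ᵐ ω ∂μ, ∀ j, 0 < K j ω) →
      ∀ t : ℝ, 0 < t → t < 1 →
      μ {ω | t < univ.sup' hne (fun j => frechetCDF (K j ω) ^ lam j)} =
      ENNReal.ofReal (1 - μ.real {ω | ∀ j, K j ω / lam j ≤ (-Real.log t)⁻¹}) := by
    intro K hK hK0 t ht0 ht1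
    have hm : MeasurableSet {ω | ∀ j, K j ω / lam j ≤ (-Real.log t)⁻¹} := by
      have : ∀ j, Measurable (fun ω => K j ω / lam j) := fun j => (hK j).div_const _
      measurability
    rw [← probReal_compl_eq_one_sub hm, ofReal_measureReal]
    refine measure_congr ?_
    filter_upwards [hK0] with ω h
    refine propext ?_
    change t < univ.sup' hne (fun j => frechetCDF (K j ω) ^ lam j) ↔
      ¬ ∀ j, K j ω / lam j ≤ (-Real.log t)⁻¹
    rw [Finset.lt_sup'_iff]
    push Not
    simp only [mem_univ, true_and]
    exact exists_congr fun j => aux_level _ _ _ (h j) (hlam j) ht0 ht1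
  have linf : ∀ (K : Fin p → Ω → ℝ), (∀ᵐ ω ∂μ, ∀ j, 0 < K j ω) →
      ∀ t : ℝ, 0 < t → t < 1 →
      μ {ω | t < univ.inf' hne (fun j => frechetCDF (K j ω) ^ lam j)} =
      ENNReal.ofReal (μ.real {ω | ∀ j, (-Real.log t)⁻¹ < K j ω / lam j}) := by
    intro K hK0 t ht0 ht1
    rw [ofReal_measureReal]
    refine measure_congr ?_
    filter_upwards [hK0] with ω h
    refine propext ?_
    change t < univ.inf' hne (fun j => frechetCDF (K j ω) ^ lam j) ↔
      ∀ j, (-Real.log t)⁻¹ < K j ω / lam j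
    rw [Finset.lt_inf'_iff]
    simp only [mem_univ, true_imp_iff]
    exact forall_congr' fun j => aux_level _ _ _ (h j) (hlam j) ht0 ht1
  have hlog : ∀ t : ℝ, 0 < t → t < 1 → 0 < (-Real.log t)⁻¹ := fun t ht0 ht1 =>
    inv_pos.2 (neg_pos.2 (Real.log_neg ht0 ht1))
  rw [integral_sub (integ _ (msup M hM) (bsup M hM0)) (integ _ (minf M hM) (binf M hM0)),
    integral_sub (integ _ (msup N hN) (bsup N hN0)) (integ _ (minf N hN) (binf N hN0))]
  refine sub_le_sub ?_ ?_
  · refine aux_stoch μ _ _ (msup M hM) (msup N hN) (bsup M hM0) (bsup N hN0) fun t ht0 ht1 => ?_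
    rw [lsup M hM hM0 t ht0 ht1, lsup N hN hN0 t ht0 ht1]
    exact ENNReal.ofReal_le_ofReal (sub_le_sub_left (h1 _ (hlog t ht0 ht1)) _)
  · refine aux_stoch μ _ _ (minf N hN) (minf M hM) (binf N hN0) (binf M hM0) fun t ht0 ht1 => ?_
    rw [linf M hM0 t ht0 ht1, linf N hN0 t ht0 ht1]
    exact ENNReal.ofReal_le_ofReal (h2 _ (hlog t ht0 ht1))

lemma aux_pos {Ω : Type*} [MeasurableSpace Ω] (μ : Measure Ω) [IsProbabilityMeasure μ]
    {d p : ℕ} (I : Fin p → Finset (Fin d)) (hIne : ∀ j, (I j).Nonempty)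
    (Z : Fin d → Ω → ℝ)
    (hm : ∀ i, ∀ t : ℝ, 0 < t → (μ {ω | Z i ω ≤ t}).toReal = frechetCDF t) :
    ∀ᵐ ω ∂μ, ∀ j, 0 < (I j).sup' (hIne j) (fun i => Z i ω) := by
  have h : ∀ i, ∀ᵐ ω ∂μ, 0 < Z i ω := by
    intro i
    have h1 : μ.real {ω | Z i ω ≤ 0} ≤ 0 := by
      have hl : Filter.Tendsto frechetCDF (nhdsWithin 0 (Set.Ioi 0)) (nhds 0) := by
        unfold frechetCDF
        exact Real.tendsto_exp_neg_atTop_nhds_zero.comp tendsto_inv_nhdsGT_zero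
      refine ge_of_tendsto hl ?_
      filter_upwards [self_mem_nhdsWithin] with t ht
      rw [← hm i t ht]
      refine measureReal_mono fun ω hω => ?_
      exact le_trans (show Z i ω ≤ 0 from hω) (le_of_lt ht)
    have h2 : μ {ω | Z i ω ≤ 0} = 0 :=
      (measureReal_eq_zero_iff).1 (le_antisymm h1 measureReal_nonneg)
    rw [ae_iff]
    simpa using h2
  filter_upwards [ae_all_iff.2 h] with ω hω j
  obtain ⟨i, hi⟩ := hIne j
  exact (hω i).trans_le (Finset.le_sup' (fun i => Z i ω) hi)

/-- The max-min coefficient of X is sandwiched between the ones of the totally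
dependent version X̄ and the independent-blocks version X̂. -/
theorem stmt11
    {Ω : Type*} [MeasurableSpace Ω] (μ : Measure Ω) [IsProbabilityMeasure μ]
    {d p : ℕ} (hd : 0 < d) (hp : 0 < p)
    (I : Fin p → Finset (Fin d)) (hIne : ∀ j, (I j).Nonempty)
    (hdisj : ∀ j k, j ≠ k → Disjoint (I j) (I k)) (hcover : ∀ i, ∃ j, i ∈ I j)
    (Xbar X Xhat : Fin d → Ω → ℝ)
    (hXbarm : ∀ i, Measurable (Xbar i)) (hXm : ∀ i, Measurable (X i))
    (hXhatm : ∀ i, Measurable (Xhat i))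
    -- all three vectors have unit Fréchet margins
    (hmarg : ∀ i, ∀ t : ℝ, 0 < t →
      (μ {ω | Xbar i ω ≤ t}).toReal = frechetCDF t ∧
      (μ {ω | X i ω ≤ t}).toReal = frechetCDF t ∧
      (μ {ω | Xhat i ω ≤ t}).toReal = frechetCDF t)
    -- all three vectors are max-stable (MEV)
    (hms : ∀ t : ℝ, 0 < t → ∀ x : Fin d → ℝ, (∀ i, 0 < x i) →
      ((μ {ω | ∀ i, Xbar i ω ≤ t * x i}).toReal) ^ t
          = (μ {ω | ∀ i, Xbar i ω ≤ x i}).toReal ∧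
      ((μ {ω | ∀ i, X i ω ≤ t * x i}).toReal) ^ t
          = (μ {ω | ∀ i, X i ω ≤ x i}).toReal ∧
      ((μ {ω | ∀ i, Xhat i ω ≤ t * x i}).toReal) ^ t
          = (μ {ω | ∀ i, Xhat i ω ≤ x i}).toReal)
    -- the blocks of X̂ are mutually independent
    (hindep : ∀ x : Fin d → ℝ,
      (μ {ω | ∀ i, Xhat i ω ≤ x i}).toReal
        = ∏ j, (μ {ω | ∀ i ∈ I j, Xhat i ω ≤ x i}).toReal)
    -- the blocks of X̄ are totally dependent
    (hdep : ∀ x : Fin d → ℝ,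
      (μ {ω | ∀ i, Xbar i ω ≤ x i}).toReal
        = Finset.univ.inf' ⟨⟨0, hp⟩, Finset.mem_univ _⟩
            (fun j => (μ {ω | ∀ i ∈ I j, Xbar i ω ≤ x i}).toReal))
    -- for each j, the blocks of X̄, X, X̂ indexed by I j are identically distributed
    (hid : ∀ j, ∀ x : Fin d → ℝ,
      μ {ω | ∀ i ∈ I j, Xbar i ω ≤ x i} = μ {ω | ∀ i ∈ I j, X i ω ≤ x i} ∧
      μ {ω | ∀ i ∈ I j, Xhat i ω ≤ x i} = μ {ω | ∀ i ∈ I j, X i ω ≤ x i})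
    (lam : Fin p → ℝ) (hlam : ∀ j, 0 < lam j) :
    (∫ ω, (Finset.univ.sup' ⟨⟨0, hp⟩, Finset.mem_univ _⟩
          (fun j => frechetCDF ((I j).sup' (hIne j) (fun i => Xbar i ω)) ^ lam j)
        - Finset.univ.inf' ⟨⟨0, hp⟩, Finset.mem_univ _⟩
          (fun j => frechetCDF ((I j).sup' (hIne j) (fun i => Xbar i ω)) ^ lam j)) ∂μ
      ≤ ∫ ω, (Finset.univ.sup' ⟨⟨0, hp⟩, Finset.mem_univ _⟩
          (fun j => frechetCDF ((I j).sup' (hIne j) (fun i => X i ω)) ^ lam j)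
        - Finset.univ.inf' ⟨⟨0, hp⟩, Finset.mem_univ _⟩
          (fun j => frechetCDF ((I j).sup' (hIne j) (fun i => X i ω)) ^ lam j)) ∂μ) ∧
    (∫ ω, (Finset.univ.sup' ⟨⟨0, hp⟩, Finset.mem_univ _⟩
          (fun j => frechetCDF ((I j).sup' (hIne j) (fun i => X i ω)) ^ lam j)
        - Finset.univ.inf' ⟨⟨0, hp⟩, Finset.mem_univ _⟩
          (fun j => frechetCDF ((I j).sup' (hIne j) (fun i => X i ω)) ^ lam j)) ∂μ
      ≤ ∫ ω, (Finset.univ.sup' ⟨⟨0, hp⟩, Finset.mem_univ _⟩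
          (fun j => frechetCDF ((I j).sup' (hIne j) (fun i => Xhat i ω)) ^ lam j)
        - Finset.univ.inf' ⟨⟨0, hp⟩, Finset.mem_univ _⟩
          (fun j => frechetCDF ((I j).sup' (hIne j) (fun i => Xhat i ω)) ^ lam j)) ∂μ) := by

  classical
  choose b hb using hcover
  have hbu : ∀ i j, i ∈ I j ↔ b i = j := by
    intro i j
    constructor
    · intro hi
      by_contra hne
      exact Finset.disjoint_left.1 (hdisj _ _ hne) (hb i) hi
    · rintro rfl; exact hb i
  have hne : (univ : Finset (Fin p)).Nonempty := ⟨⟨0, hp⟩, Finset.mem_univ _⟩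
  let mx : (Fin d → Ω → ℝ) → Fin p → Ω → ℝ := fun Z j ω => (I j).sup' (hIne j) (fun i => Z i ω)
  have hmx : ∀ Z : Fin d → Ω → ℝ, (∀ i, Measurable (Z i)) → ∀ j, Measurable (mx Z j) := by
    intro Z hZ j
    have := Finset.measurable_sup' (hIne j) (f := Z) fun i _ => hZ i
    convert this using 1
    ext ω; simp [mx, Finset.sup'_apply]
  have hmxd : ∀ Z : Fin d → Ω → ℝ, (∀ i, Measurable (Z i)) → ∀ j,
      Measurable (fun ω => mx Z j ω / lam j) := fun Z hZ j => (hmx Z hZ j).div_const _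
  -- translation of block events
  have hev : ∀ (Z : Fin d → Ω → ℝ) (j : Fin p) (s : ℝ) (ω : Ω),
      mx Z j ω / lam j ≤ s ↔ ∀ i ∈ I j, Z i ω ≤ s * lam (b i) := by
    intro Z j s ω
    rw [div_le_iff₀ (hlam j), Finset.sup'_le_iff]
    refine forall₂_congr fun i hi => ?_
    rw [(hbu i j).1 hi]
  have hevR : ∀ (Z : Fin d → Ω → ℝ) (R : Finset (Fin p)) (s : ℝ),
      {ω | ∀ j ∈ R, mx Z j ω / lam j ≤ s} =
        {ω | ∀ i, True → b i ∈ R → Z i ω ≤ s * lam (b i)} := by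
    intro Z R s
    ext ω
    change (∀ j ∈ R, mx Z j ω / lam j ≤ s) ↔ ∀ i, True → b i ∈ R → Z i ω ≤ s * lam (b i)
    simp only [hev]
    constructor
    · intro h i _ hi; exact h (b i) hi i (hb i)
    · intro h j hj i hi
      have := (hbu i j).1 hi
      exact h i trivial (this ▸ hj)
  have hevj : ∀ (Z : Fin d → Ω → ℝ) (j : Fin p) (s : ℝ),
      {ω | mx Z j ω / lam j ≤ s} = {ω | ∀ i ∈ I j, Z i ω ≤ s * lam (b i)} := by
    intro Z j s; ext ω; exact hev Z j s ω
  have hmargj : ∀ j s, μ.real {ω | mx Xbar j ω / lam j ≤ s} = μ.real {ω | mx X j ω / lam j ≤ s} ∧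
      μ.real {ω | mx Xhat j ω / lam j ≤ s} = μ.real {ω | mx X j ω / lam j ≤ s} := by
    intro j s
    simp only [hevj, measureReal_def]
    have := hid j (fun i => s * lam (b i))
    exact ⟨by rw [this.1], by rw [this.2]⟩
  -- scaling of the block maxima of X
  have hscale : ∀ R : Finset (Fin p), ∀ t s : ℝ, 0 < t → 0 < s →
      (μ.real {ω | ∀ j ∈ R, mx X j ω / lam j ≤ t * s}) ^ t =
        μ.real {ω | ∀ j ∈ R, mx X j ω / lam j ≤ s} := by
    intro R t s ht hs
    rw [hevR, hevR]
    have l1 := aux_lim μ X (fun _ => True) (fun i => b i ∈ R) (fun i => s * lam (b i))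
    have l2 := (aux_lim μ X (fun _ => True) (fun i => b i ∈ R) (fun i => t * s * lam (b i))).comp
      (Filter.tendsto_id.const_mul_atTop ht)
    have l3 := l2.rpow_const (p := t) (Or.inr ht.le)
    refine tendsto_nhds_unique l3 (l1.congr' ?_)
    filter_upwards [Filter.eventually_gt_atTop 0] with m hm
    have := (hms t ht (fun i => if b i ∈ R then s * lam (b i) else m) (fun i => by
      have := hlam (b i)
      split_ifs <;> positivity)).2.1
    simp only [Function.comp_apply, measureReal_def, true_imp_iff, id]
    rw [← this]
    simp only [mul_ite, mul_assoc]
  have hassoc := aux_assoc μ (fun j ω => mx X j ω / lam j) (hmxd X hXm) hscale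
  -- independence
  have hhat : ∀ (R : Finset (Fin p)) (s : ℝ), μ.real {ω | ∀ j ∈ R, mx Xhat j ω / lam j ≤ s} =
      ∏ j ∈ R, μ.real {ω | mx Xhat j ω / lam j ≤ s} := by
    intro R s
    rw [hevR]
    have l1 := aux_lim μ Xhat (fun _ => True) (fun i => b i ∈ R) (fun i => s * lam (b i))
    have l2 := tendsto_finsetProd univ fun j (_ : j ∈ univ) =>
      aux_lim μ Xhat (fun i => i ∈ I j) (fun i => b i ∈ R) (fun i => s * lam (b i))
    have e : ∀ m : ℝ, ∏ j, μ.real {ω | ∀ i ∈ I j, Xhat i ω ≤ if b i ∈ R then s * lam (b i) else m}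
        = μ.real {ω | ∀ i, True → Xhat i ω ≤ if b i ∈ R then s * lam (b i) else m} := by
      intro m
      have := hindep (fun i => if b i ∈ R then s * lam (b i) else m)
      simp only [measureReal_def, true_imp_iff]
      exact this.symm
    simp only [e] at l2
    rw [tendsto_nhds_unique l1 l2, ← Finset.prod_subset (Finset.subset_univ R)]
    · refine Finset.prod_congr rfl fun j hj => ?_
      rw [hevj]
      congr 1
      ext ω
      refine forall₂_congr fun i hi => ?_
      simp [(hbu i j).1 hi, hj]
    · intro j _ hj
      have : {ω | ∀ i ∈ I j, b i ∈ R → Xhat i ω ≤ s * lam (b i)} = Set.univ := by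
        refine Set.eq_univ_of_forall fun ω i hi hR => ?_
        rw [(hbu i j).1 hi] at hR
        exact absurd hR hj
      rw [this, probReal_univ]
  have hhat2 : ∀ s : ℝ, μ.real {ω | ∀ j, s < mx Xhat j ω / lam j} =
      ∏ j, (1 - μ.real {ω | mx Xhat j ω / lam j ≤ s}) := by
    intro s
    rw [aux_incl_excl μ (fun j ω => mx Xhat j ω / lam j) (hmxd Xhat hXhatm) s, aux_prod_one_sub]
    exact Finset.sum_congr rfl fun R _ => by rw [hhat]
  -- total dependence
  have hbar : ∀ (R : Finset (Fin p)) (s : ℝ), μ.real {ω | ∀ j ∈ R, mx Xbar j ω / lam j ≤ s} =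
      univ.inf' hne fun j => if j ∈ R then μ.real {ω | mx Xbar j ω / lam j ≤ s} else 1 := by
    intro R s
    rw [hevR]
    have l1 := aux_lim μ Xbar (fun _ => True) (fun i => b i ∈ R) (fun i => s * lam (b i))
    have l2 := Filter.Tendsto.finset_inf'_nhds_apply hne fun j (_ : j ∈ univ) =>
      aux_lim μ Xbar (fun i => i ∈ I j) (fun i => b i ∈ R) (fun i => s * lam (b i))
    have e : ∀ m : ℝ, univ.inf' hne
        (fun j => μ.real {ω | ∀ i ∈ I j, Xbar i ω ≤ if b i ∈ R then s * lam (b i) else m})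
        = μ.real {ω | ∀ i, True → Xbar i ω ≤ if b i ∈ R then s * lam (b i) else m} := by
      intro m
      have := hdep (fun i => if b i ∈ R then s * lam (b i) else m)
      simp only [measureReal_def, true_imp_iff]
      exact this.symm
    simp only [e] at l2
    rw [tendsto_nhds_unique l1 l2]
    refine Finset.inf'_congr _ rfl fun j _ => ?_
    split_ifs with hj
    · rw [hevj]
      congr 1
      ext ω
      refine forall₂_congr fun i hi => ?_
      simp [(hbu i j).1 hi, hj]
    · have : {ω | ∀ i ∈ I j, b i ∈ R → Xbar i ω ≤ s * lam (b i)} = Set.univ := by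
        refine Set.eq_univ_of_forall fun ω i hi hR => ?_
        rw [(hbu i j).1 hi] at hR
        exact absurd hR hj
      rw [this, probReal_univ]
  have hcompl : ∀ Z : Fin d → Ω → ℝ, (∀ i, Measurable (Z i)) → ∀ s : ℝ,
      μ.real {ω | ∀ j, s < mx Z j ω / lam j} =
        1 - μ.real (⋃ j, {ω | mx Z j ω / lam j ≤ s}) := by
    intro Z hZ s
    rw [← probReal_compl_eq_one_sub]
    · congr 1
      ext ω
      simp
    · exact MeasurableSet.iUnion fun j => measurableSet_le (hmxd Z hZ j) measurable_const
  have hbar2 : ∀ s : ℝ, μ.real {ω | ∀ j, s < mx X j ω / lam j} ≤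
      μ.real {ω | ∀ j, s < mx Xbar j ω / lam j} := by
    intro s
    rw [hcompl X hXm, hcompl Xbar hXbarm]
    refine sub_le_sub_left ?_ _
    obtain ⟨k, -, hk⟩ := Finset.exists_max_image univ
      (fun j => μ.real {ω | mx Xbar j ω / lam j ≤ s}) hne
    have hnull : ∀ j, μ ({ω | mx Xbar j ω / lam j ≤ s} \ {ω | mx Xbar k ω / lam k ≤ s}) = 0 := by
      intro j
      have h1 : μ.real {ω | mx Xbar j ω / lam j ≤ s} ≤
          μ.real ({ω | mx Xbar j ω / lam j ≤ s} ∩ {ω | mx Xbar k ω / lam k ≤ s}) := by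
        have h2 : {ω | mx Xbar j ω / lam j ≤ s} ∩ {ω | mx Xbar k ω / lam k ≤ s} =
            {ω | ∀ l ∈ ({j, k} : Finset (Fin p)), mx Xbar l ω / lam l ≤ s} := by
          ext ω; simp
        rw [h2, hbar]
        refine Finset.le_inf' _ _ fun l _ => ?_
        split_ifs with hl
        · rcases Finset.mem_insert.1 hl with rfl | hl
          · exact le_rfl
          · rw [Finset.mem_singleton.1 hl]; exact hk j (mem_univ j)
        · exact measureReal_le_one
      have h3 := measureReal_inter_add_sdiff (μ := μ) (s := {ω | mx Xbar j ω / lam j ≤ s})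
        (measurableSet_le (hmxd Xbar hXbarm k) (measurable_const (a := s)))
      have h4 : μ.real ({ω | mx Xbar j ω / lam j ≤ s} \ {ω | mx Xbar k ω / lam k ≤ s}) = 0 :=
        le_antisymm (by linarith) measureReal_nonneg
      exact (measureReal_eq_zero_iff).1 h4
    have hle : μ (⋃ j, {ω | mx Xbar j ω / lam j ≤ s}) ≤ μ {ω | mx Xbar k ω / lam k ≤ s} := by
      refine measure_mono_ae ?_
      have : ∀ᵐ ω ∂μ, ∀ j, ω ∉ ({ω | mx Xbar j ω / lam j ≤ s} \ {ω | mx Xbar k ω / lam k ≤ s}) :=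
        ae_all_iff.2 fun j => measure_eq_zero_iff_ae_notMem.1 (hnull j)
      filter_upwards [this] with ω hω hu
      obtain ⟨j, hj⟩ := Set.mem_iUnion.1 hu
      by_contra hc
      exact hω j ⟨hj, hc⟩
    calc μ.real (⋃ j, {ω | mx Xbar j ω / lam j ≤ s})
        ≤ μ.real {ω | mx Xbar k ω / lam k ≤ s} := ENNReal.toReal_mono (measure_ne_top _ _) hle
      _ = μ.real {ω | mx X k ω / lam k ≤ s} := (hmargj k s).1
      _ ≤ _ := measureReal_mono (Set.subset_iUnion (fun j => {ω | mx X j ω / lam j ≤ s}) k)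
  have huniv : ∀ (Z : Fin d → Ω → ℝ) (s : ℝ), μ.real {ω | ∀ j, mx Z j ω / lam j ≤ s} =
      μ.real {ω | ∀ j ∈ (univ : Finset (Fin p)), mx Z j ω / lam j ≤ s} := by
    intro Z s; simp
  have pbar := aux_pos μ I hIne Xbar fun i t ht => (hmarg i t ht).1
  have pX := aux_pos μ I hIne X fun i t ht => (hmarg i t ht).2.1
  have phat := aux_pos μ I hIne Xhat fun i t ht => (hmarg i t ht).2.2
  constructor
  · refine aux_cmp μ hne lam hlam (mx Xbar) (mx X) (hmx _ hXbarm) (hmx _ hXm) pbar pX ?_ ?_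
    · intro s hs
      rw [huniv Xbar, hbar]
      refine Finset.le_inf' _ _ fun j _ => ?_
      rw [if_pos (mem_univ j), (hmargj j s).1]
      exact measureReal_mono fun ω h => h j
    · exact fun s _ => hbar2 s
  · refine aux_cmp μ hne lam hlam (mx X) (mx Xhat) (hmx _ hXm) (hmx _ hXhatm) pX phat ?_ ?_
    · intro s hs
      rw [huniv Xhat, hhat]
      refine le_trans (le_of_eq ?_) (hassoc s hs).1
      exact Finset.prod_congr rfl fun j _ => (hmargj j s).2
    · intro s hs
      rw [hhat2]
      refine le_trans (le_of_eq ?_) (hassoc s hs).2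
      exact Finset.prod_congr rfl fun j _ => by rw [(hmargj j s).2]
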